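/- Policy (simulation) difference lemma: let p and p' be two transition kernels on the same finite MDP, let π be a stationary policy, r : 𝒮×𝒜 → ℝ a reward function, d ≥ 1 a horizon, and μ₁ an initial distribution. Then W_d^π(r, p, μ₁) − W_d^π(r, p', μ₁) = Σ_{h=1}^{d} Σ_{(s,a)} Pr_{π,p}[(s_h,a_h) = (s,a) | s₁ ∼ μ₁] · Σ_{s'} (p_{s,a,s'} − p'_{s,a,s'}) · W_{d−h}^π(r, p', 1_{s'}), where W_0^π := 0 and the trajectory probabilities Pr_{π,p} are taken under transition p. -/

import Mathlib

open scoped Classical BigOperators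

/-- `valS p r π d s` is the expected total reward `E[Σ_{h=1}^d r(s_h,a_h)]` collected in `d`
steps following the stationary policy `π` under the transition kernel `p`, starting from `s`. -/
noncomputable def valS {S A : Type*} [Fintype S] (p : S → A → S → ℝ)
    (r : S → A → ℝ) (π : S → A) : ℕ → S → ℝ
  | 0, _ => 0
  | d + 1, s => r s (π s) + ∑ s' : S, p s (π s) s' * valS p r π d s'

/-- `W_d^π(r, p, μ)`: expected total reward in `d` steps, from initial distribution `μ`. -/
noncomputable def W {S A : Type*} [Fintype S] (p : S → A → S → ℝ)
    (r : S → A → ℝ) (π : S → A) (d : ℕ) (μ : S → ℝ) : ℝ :=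
  ∑ s : S, μ s * valS p r π d s

/-- Distribution of the state at step `n+1` (0-indexed `n`), following the stationary policy
`π` under the transition kernel `p`, starting from the initial distribution `μ`. So
`stepDist p π μ (h-1) s * 1[π s = a] = Pr_{π,p}[(s_h, a_h) = (s, a)]`. -/
noncomputable def stepDist {S A : Type*} [Fintype S] (p : S → A → S → ℝ) (π : S → A)
    (μ : S → ℝ) : ℕ → S → ℝ
  | 0, s => μ s
  | n + 1, s' => ∑ s : S, stepDist p π μ n s * p s (π s) s'

/-- Running `n + 1` steps from `μ` is running `n` steps from the one-step distribution. -/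
theorem stepDist_succ_eq {S A : Type*} [Fintype S] (p : S → A → S → ℝ) (π : S → A)
    (μ : S → ℝ) (n : ℕ) :
    stepDist p π μ (n + 1) = stepDist p π (stepDist p π μ 1) n := by
  induction n with
  | zero => rfl
  | succ n ih =>
    funext s'
    rw [stepDist, ih, stepDist]

/-- First-step decomposition of the expected total reward. -/
theorem W_succ {S A : Type*} [Fintype S] (p : S → A → S → ℝ) (r : S → A → ℝ) (π : S → A)
    (d : ℕ) (μ : S → ℝ) :
    W p r π (d + 1) μ = ∑ s, μ s * r s (π s) + W p r π d (stepDist p π μ 1) := by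
  simp only [W, valS, stepDist, mul_add, Finset.sum_add_distrib, Finset.mul_sum, Finset.sum_mul]
  rw [Finset.sum_comm (f := fun s s' => μ s * (p s (π s) s' * valS p r π d s'))]
  simp only [mul_assoc]

/-- The simulation difference lemma with zero-indexed steps and the action substituted. -/
theorem W_sub_W_eq_sum_range {S A : Type*} [Fintype S] (p p' : S → A → S → ℝ)
    (r : S → A → ℝ) (π : S → A) (d : ℕ) (μ : S → ℝ) :
    W p r π d μ - W p' r π d μ =
      ∑ n ∈ Finset.range d, ∑ s, stepDist p π μ n s *
        ∑ s', (p s (π s) s' - p' s (π s) s') * valS p' r π (d - (n + 1)) s' := by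
  induction d generalizing μ with
  | zero => simp [W, valS]
  | succ d ih =>
    have key : W p' r π d (stepDist p π μ 1) - W p' r π d (stepDist p' π μ 1) =
        ∑ s, μ s * ∑ s', (p s (π s) s' - p' s (π s) s') * valS p' r π d s' := by
      simp only [W, stepDist, sub_mul, mul_sub, Finset.sum_sub_distrib, Finset.mul_sum,
        Finset.sum_mul, mul_assoc]
      congr 1 <;> exact Finset.sum_comm
    have shift := ih (stepDist p π μ 1)
    simp only [← stepDist_succ_eq] at shift
    rw [Finset.sum_range_succ', W_succ, W_succ]
    simp only [Nat.add_sub_add_right, ← shift, zero_add, Nat.add_sub_cancel]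
    simp only [stepDist] at key ⊢
    linarith

/-- Policy (simulation) difference lemma:
`W_d^π(r,p,μ₁) − W_d^π(r,p',μ₁)
  = Σ_{h=1}^d Σ_{(s,a)} Pr_{π,p}[(s_h,a_h)=(s,a)] Σ_{s'} (p_{s,a,s'} − p'_{s,a,s'})
      W_{d−h}^π(r,p',1_{s'})`. -/
theorem policy_difference {S A : Type*} [Fintype S] [Fintype A]
    (p p' : S → A → S → ℝ)
    (hp0 : ∀ s a s', 0 ≤ p s a s') (hp1 : ∀ s a, ∑ s' : S, p s a s' = 1)
    (hp'0 : ∀ s a s', 0 ≤ p' s a s') (hp'1 : ∀ s a, ∑ s' : S, p' s a s' = 1)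
    (π : S → A) (r : S → A → ℝ) (d : ℕ) (hd : 1 ≤ d)
    (μ₁ : S → ℝ) (hμ0 : ∀ s, 0 ≤ μ₁ s) (hμ1 : ∑ s : S, μ₁ s = 1) :
    W p r π d μ₁ - W p' r π d μ₁ =
      ∑ h ∈ Finset.Icc 1 d, ∑ s : S, ∑ a : A,
        (if π s = a then stepDist p π μ₁ (h - 1) s else 0) *
          ∑ s' : S, (p s a s' - p' s a s') * valS p' r π (d - h) s' := by
  rw [W_sub_W_eq_sum_range, ← Finset.Ico_add_one_right_eq_Icc, Finset.sum_Ico_eq_sum_range]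
  simp [ite_mul, add_comm 1]
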